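/- For every integer n ≥ 1, with m determined by n as indicated, the following identity holds in ℚ(q): ∑_{r=0}^{n} (-1)^r q^{(r-1)(r-2)/2} (-q;q)_{n-r} [2n-r+1 choose r]_q · (1-q^{2n+1})/(1-q^{2n-r+1}) equals (-1)^m q^{(m-1)(3m-2)} if n = 2m-1 is odd, and equals (-1)^m q^{m(3m+1)+1} if n = 2m is even. (Here the exponent (r-1)(r-2)/2 is the polynomial value of the binomial coefficient C(r-1,2); in particular it equals 1 when r = 0.) -/

import Mathlib

open Finset

/-- The indeterminate `q`, as an element of the field `ℚ(q)` of rational functions. -/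
noncomputable def q : RatFunc ℚ := RatFunc.X

/-- The q-Pochhammer symbol `(a; q)_n` for a nonnegative integer `n`. -/
noncomputable def qPoch (a : RatFunc ℚ) (n : ℕ) : RatFunc ℚ :=
  ∏ k ∈ Finset.range n, (1 - a * q ^ k)

/-- The q-Pochhammer symbol `(a; q)_n` for an arbitrary integer `n`, where for `n > 0`
`(a; q)_{-n} = 1 / (a q^{-n}; q)_n`. -/
noncomputable def qPochZ (a : RatFunc ℚ) (n : ℤ) : RatFunc ℚ :=
  if 0 ≤ n then qPoch a n.toNat else 1 / qPoch (a * q ^ n) (-n).toNat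

/-- The Gaussian (q-)binomial coefficient `[n choose m]_q`, equal to
`(q;q)_n / ((q;q)_m (q;q)_{n-m})` for `0 ≤ m ≤ n` and `0` otherwise. -/
noncomputable def qbinom (n m : ℤ) : RatFunc ℚ :=
  if 0 ≤ m ∧ m ≤ n then
    qPoch q n.toNat / (qPoch q m.toNat * qPoch q (n - m).toNat)
  else 0

theorem q_pow_ne_one {n : ℕ} (hn : n ≠ 0) : q ^ n ≠ 1 := by
  intro h
  have h' : (RatFunc.X : RatFunc ℚ) ^ n = 1 := h
  rw [← RatFunc.algebraMap_X, ← map_pow, ← map_one (algebraMap (Polynomial ℚ) (RatFunc ℚ))] at h'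
  have h'' := congrArg Polynomial.natDegree (RatFunc.algebraMap_injective ℚ h')
  simp [hn] at h''

theorem one_sub_q_pow_ne_zero (n : ℕ) : 1 - q ^ (n + 1) ≠ 0 :=
  sub_ne_zero.mpr (q_pow_ne_one n.succ_ne_zero).symm

theorem qPoch_zero (a : RatFunc ℚ) : qPoch a 0 = 1 := by simp [qPoch]

theorem qPoch_q_succ (n : ℕ) : qPoch q (n + 1) = qPoch q n * (1 - q ^ (n + 1)) := by
  rw [qPoch, prod_range_succ, ← qPoch, pow_succ']

theorem qPoch_neg_q_succ (n : ℕ) : qPoch (-q) (n + 1) = qPoch (-q) n * (1 + q ^ (n + 1)) := by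
  rw [qPoch, prod_range_succ, ← qPoch, pow_succ']
  ring

theorem qPoch_q_ne_zero (n : ℕ) : qPoch q n ≠ 0 := by
  induction n with
  | zero => simp [qPoch_zero]
  | succ n ih => exact qPoch_q_succ n ▸ mul_ne_zero ih (one_sub_q_pow_ne_zero n)

/-- The Gaussian binomial coefficient at natural numbers. -/
noncomputable def gaussBinom (n k : ℕ) : RatFunc ℚ := qbinom n k

theorem gaussBinom_add (k j : ℕ) :
    gaussBinom (k + j) k = qPoch q (k + j) / (qPoch q k * qPoch q j) := by
  rw [gaussBinom, qbinom, if_pos (by omega), show ((k + j : ℕ) - k : ℤ) = j by omega,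
    Int.toNat_natCast, Int.toNat_natCast, Int.toNat_natCast]

theorem gaussBinom_of_lt {n k : ℕ} (h : n < k) : gaussBinom n k = 0 :=
  if_neg (by omega)

theorem gaussBinom_zero_right (n : ℕ) : gaussBinom n 0 = 1 := by
  have h := gaussBinom_add 0 n
  rwa [zero_add, qPoch_zero, one_mul, div_self (qPoch_q_ne_zero n)] at h

theorem gaussBinom_self (n : ℕ) : gaussBinom n n = 1 := by
  have h := gaussBinom_add n 0
  rwa [add_zero, qPoch_zero, mul_one, div_self (qPoch_q_ne_zero n)] at h

theorem gaussBinom_succ_succ (n k : ℕ) :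
    gaussBinom (n + 1) (k + 1) = gaussBinom n k + q ^ (k + 1) * gaussBinom n (k + 1) := by
  rcases lt_trichotomy n k with h | rfl | h
  · simp [gaussBinom_of_lt, h, h.trans (Nat.lt_succ_self k)]
  · simp [gaussBinom_self, gaussBinom_of_lt]
  · obtain ⟨j, rfl⟩ := Nat.exists_eq_add_of_lt h
    have h₁ := gaussBinom_add (k + 1) (j + 1)
    have h₂ := gaussBinom_add k (j + 1)
    have h₃ := gaussBinom_add (k + 1) j
    rw [show k + 1 + (j + 1) = k + j + 1 + 1 by ring] at h₁
    rw [show k + (j + 1) = k + j + 1 by ring] at h₂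
    rw [show k + 1 + j = k + j + 1 by ring] at h₃
    rw [h₁, h₂, h₃, qPoch_q_succ (k + j + 1), qPoch_q_succ k, qPoch_q_succ j]
    have := qPoch_q_ne_zero k
    have := qPoch_q_ne_zero j
    have := one_sub_q_pow_ne_zero k
    have := one_sub_q_pow_ne_zero j
    field_simp
    ring

/-- The absorption identity for Gaussian binomial coefficients. -/
theorem one_sub_mul_gaussBinom_succ_succ (n k : ℕ) :
    (1 - q ^ (k + 1)) * gaussBinom (n + 1) (k + 1) = (1 - q ^ (n + 1)) * gaussBinom n k := by
  rcases lt_or_ge n k with h | h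
  · simp [gaussBinom_of_lt, h]
  · obtain ⟨j, rfl⟩ := Nat.exists_eq_add_of_le h
    have h₁ := gaussBinom_add (k + 1) j
    rw [show k + 1 + j = k + j + 1 by ring] at h₁
    rw [h₁, gaussBinom_add k j, qPoch_q_succ (k + j), qPoch_q_succ k]
    have := qPoch_q_ne_zero k
    have := qPoch_q_ne_zero j
    have := one_sub_q_pow_ne_zero k
    field_simp

theorem gaussBinom_succ_succ' (k j : ℕ) :
    gaussBinom (k + j + 1) (k + 1) =
      q ^ j * gaussBinom (k + j) k + gaussBinom (k + j) (k + 1) := by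
  have h₁ := gaussBinom_succ_succ (k + j) k
  have h₂ := one_sub_mul_gaussBinom_succ_succ (k + j) k
  have h : q ^ (k + 1) * (gaussBinom (k + j + 1) (k + 1) -
      (q ^ j * gaussBinom (k + j) k + gaussBinom (k + j) (k + 1))) = 0 := by
    rw [h₁] at h₂ ⊢
    linear_combination -h₂
  exact sub_eq_zero.mp ((mul_eq_zero.mp h).resolve_left (pow_ne_zero _ RatFunc.X_ne_zero))

theorem gaussBinom_mul_div (n k : ℕ) :
    gaussBinom (n + 1) (k + 1) * ((1 - q ^ (n + k + 2)) / (1 - q ^ (n + 1))) =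
      q ^ (k + 1) * gaussBinom (n + 1) (k + 1) + gaussBinom n k := by
  have := one_sub_q_pow_ne_zero n
  field_simp
  linear_combination one_sub_mul_gaussBinom_succ_succ n k

/-- The sum `∑ r, (-1)^r q^(r(r-1)/2 + a r) (-q;q)_(n-r) [2n-r, r]_q`. -/
noncomputable def evenSum (a n : ℕ) : RatFunc ℚ :=
  ∑ r ∈ range (n + 1),
    (-1) ^ r * q ^ (r.choose 2 + a * r) * qPoch (-q) (n - r) * gaussBinom (2 * n - r) r

/-- The sum `∑ r, (-1)^r q^(r(r-1)/2 + a r) (-q;q)_(n-r) [2n+1-r, r]_q`. -/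
noncomputable def oddSum (a n : ℕ) : RatFunc ℚ :=
  ∑ r ∈ range (n + 1),
    (-1) ^ r * q ^ (r.choose 2 + a * r) * qPoch (-q) (n - r) * gaussBinom (2 * n + 1 - r) r

theorem choose_succ_two (s : ℕ) : (s + 1).choose 2 = s.choose 2 + s := by
  rw [Nat.choose_succ_succ' s 1, Nat.choose_one_right, add_comm]

theorem oddSum_eq_sum_range_add_two (a n : ℕ) :
    oddSum a n = ∑ r ∈ range (n + 2),
      (-1) ^ r * q ^ (r.choose 2 + a * r) * qPoch (-q) (n - r) * gaussBinom (2 * n + 1 - r) r := by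
  rw [sum_range_succ _ (n + 1), gaussBinom_of_lt (by omega : 2 * n + 1 - (n + 1) < n + 1),
    mul_zero, add_zero, oddSum]

theorem oddSum_zero_succ (n : ℕ) :
    oddSum 0 (n + 1) = evenSum 1 (n + 1) - oddSum 1 n := by
  rw [oddSum, evenSum, oddSum, sum_range_succ', sum_range_succ' _ (n + 1), add_sub_right_comm,
    ← sum_sub_distrib]
  congr 1
  · refine sum_congr rfl fun s hs => ?_
    obtain ⟨j, rfl⟩ := Nat.exists_eq_add_of_le (mem_range_succ_iff.mp hs)
    rw [show 2 * (s + j + 1) + 1 - (s + 1) = s + 2 * j + 1 + 1 by omega,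
      show 2 * (s + j + 1) - (s + 1) = s + 2 * j + 1 by omega,
      show 2 * (s + j) + 1 - s = s + 2 * j + 1 by omega,
      gaussBinom_succ_succ, choose_succ_two, Nat.add_sub_add_right]
    ring
  · simp [gaussBinom_zero_right]

theorem oddSum_one_succ (n : ℕ) :
    oddSum 1 (n + 1) = evenSum 1 (n + 1) - q ^ (2 * n + 2) * oddSum 0 n := by
  rw [oddSum, evenSum, oddSum, sum_range_succ', sum_range_succ' _ (n + 1), mul_sum,
    add_sub_right_comm, ← sum_sub_distrib]
  congr 1
  · refine sum_congr rfl fun s hs => ?_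
    obtain ⟨j, rfl⟩ := Nat.exists_eq_add_of_le (mem_range_succ_iff.mp hs)
    rw [show 2 * (s + j + 1) + 1 - (s + 1) = s + (2 * j + 1) + 1 by omega,
      show 2 * (s + j + 1) - (s + 1) = s + (2 * j + 1) by omega,
      show 2 * (s + j) + 1 - s = s + (2 * j + 1) by omega,
      gaussBinom_succ_succ', choose_succ_two, Nat.add_sub_add_right]
    ring
  · simp [gaussBinom_zero_right]

theorem qPoch_mul_gaussBinom (s j : ℕ) :
    qPoch (-q) j * gaussBinom (s + 2 * j) (s + 1) =
      (1 + q ^ j) * qPoch (-q) (j - 1) * gaussBinom (s + 2 * j) (s + 1) := by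
  cases j with
  | zero => simp [gaussBinom_of_lt]
  | succ j =>
    rw [qPoch_neg_q_succ, Nat.add_sub_cancel]
    ring

theorem evenSum_one_succ (n : ℕ) :
    evenSum 1 (n + 1) =
      oddSum 1 n + q ^ (n + 1) * oddSum 0 n - q ^ (2 * n + 1) * evenSum 0 n := by
  have h : evenSum 1 (n + 1) + q ^ (2 * n + 1) * evenSum 0 n =
      oddSum 1 n + q ^ (n + 1) * oddSum 0 n := by
    rw [oddSum_eq_sum_range_add_two, oddSum_eq_sum_range_add_two, evenSum, evenSum, mul_sum,
      mul_sum, ← sum_add_distrib, sum_range_succ', sum_range_succ' _ (n + 1), add_right_comm,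
      ← sum_add_distrib]
    congr 1
    · refine sum_congr rfl fun s hs => ?_
      obtain ⟨j, rfl⟩ := Nat.exists_eq_add_of_le (mem_range_succ_iff.mp hs)
      rw [show 2 * (s + j + 1) - (s + 1) = s + 2 * j + 1 by omega,
        show 2 * (s + j) + 1 - (s + 1) = s + 2 * j by omega,
        show 2 * (s + j) - s = s + 2 * j by omega,
        show s + j + 1 - (s + 1) = j by omega, show s + j - (s + 1) = j - 1 by omega,
        show s + j - s = j by omega, gaussBinom_succ_succ', choose_succ_two]
      linear_combination (-1) ^ (s + 1) * q ^ (s.choose 2 + 2 * s + 1) * qPoch_mul_gaussBinom s j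
    · simp [gaussBinom_zero_right, qPoch_neg_q_succ]
      ring
  exact eq_sub_of_add_eq h

theorem evenSum_zero_succ (n : ℕ) :
    evenSum 0 (n + 1) = oddSum 1 n + q ^ (n + 1) * oddSum 0 n - evenSum 1 n := by
  have h : evenSum 0 (n + 1) + evenSum 1 n = oddSum 1 n + q ^ (n + 1) * oddSum 0 n := by
    rw [oddSum_eq_sum_range_add_two, oddSum_eq_sum_range_add_two, evenSum, evenSum,
      mul_sum, ← sum_add_distrib, sum_range_succ', sum_range_succ' _ (n + 1), add_right_comm,
      ← sum_add_distrib]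
    congr 1
    · refine sum_congr rfl fun s hs => ?_
      obtain ⟨j, rfl⟩ := Nat.exists_eq_add_of_le (mem_range_succ_iff.mp hs)
      rw [show 2 * (s + j + 1) - (s + 1) = s + 2 * j + 1 by omega,
        show 2 * (s + j) + 1 - (s + 1) = s + 2 * j by omega,
        show 2 * (s + j) - s = s + 2 * j by omega,
        show s + j + 1 - (s + 1) = j by omega, show s + j - (s + 1) = j - 1 by omega,
        show s + j - s = j by omega, gaussBinom_succ_succ, choose_succ_two]
      linear_combination (-1) ^ (s + 1) * q ^ (s.choose 2 + 2 * s + 1) * qPoch_mul_gaussBinom s j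
    · simp [gaussBinom_zero_right, qPoch_neg_q_succ]
      ring
  exact eq_sub_of_add_eq h

theorem oddSum_zero_succ_eq (n : ℕ) :
    oddSum 0 (n + 1) = q ^ (n + 1) * oddSum 0 n - q ^ (2 * n + 1) * evenSum 0 n := by
  rw [oddSum_zero_succ, evenSum_one_succ]
  ring

theorem evenSum_zero_add_two (n : ℕ) :
    evenSum 0 (n + 2) = q ^ (n + 2) * oddSum 0 (n + 1) - q ^ (2 * n + 2) * oddSum 0 n := by
  rw [evenSum_zero_succ, oddSum_one_succ]
  ring

theorem oddSum_zero_zero : oddSum 0 0 = 1 := by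
  simp [oddSum, gaussBinom_zero_right, qPoch_zero]

theorem evenSum_zero_zero : evenSum 0 0 = 1 := by
  simp [evenSum, gaussBinom_zero_right, qPoch_zero]

theorem evenSum_zero_one : evenSum 0 1 = q := by
  rw [evenSum_zero_succ]
  simp [evenSum, oddSum, gaussBinom_zero_right, qPoch_zero]

theorem oddSum_evenSum_closed_form (k : ℕ) :
    oddSum 0 (2 * k) = (-1) ^ k * q ^ (3 * k ^ 2 + k) ∧ oddSum 0 (2 * k + 1) = 0 ∧
      evenSum 0 (2 * k + 1) = (-1) ^ k * q ^ (3 * k ^ 2 + 3 * k + 1) := by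
  induction k with
  | zero =>
    refine ⟨by simp [oddSum_zero_zero], ?_, by simp [evenSum_zero_one]⟩
    rw [oddSum_zero_succ_eq]
    simp [oddSum_zero_zero, evenSum_zero_zero]
  | succ k ih =>
    obtain ⟨h₁, h₂, h₃⟩ := ih
    have h₄ : oddSum 0 (2 * (k + 1)) = (-1) ^ (k + 1) * q ^ (3 * (k + 1) ^ 2 + (k + 1)) := by
      rw [show 2 * (k + 1) = 2 * k + 1 + 1 by ring, oddSum_zero_succ_eq, h₂, h₃]
      ring
    have h₅ : evenSum 0 (2 * (k + 1)) = (-1) ^ (k + 1) * q ^ (3 * k ^ 2 + 5 * k + 2) := by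
      rw [show 2 * (k + 1) = 2 * k + 2 by ring, evenSum_zero_add_two, h₁, h₂]
      ring
    have h₆ : oddSum 0 (2 * (k + 1) + 1) = 0 := by
      rw [oddSum_zero_succ_eq, h₄, h₅]
      ring
    refine ⟨h₄, h₆, ?_⟩
    rw [show 2 * (k + 1) + 1 = 2 * k + 1 + 2 by ring, evenSum_zero_add_two, h₂,
      show 2 * k + 1 + 1 = 2 * (k + 1) by ring, h₄]
    ring

theorem choose_two_ediv (s : ℕ) : (s : ℤ) * ((s : ℤ) - 1) / 2 = (s.choose 2 : ℕ) := by
  refine Int.ediv_eq_of_eq_mul_left two_ne_zero ?_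
  induction s with
  | zero => simp
  | succ s ih =>
    rw [choose_succ_two]
    push_cast
    linarith

theorem sum_eq_q_mul_oddSum_sub_oddSum (n : ℕ) :
    ∑ r ∈ Finset.range (n + 1 + 1),
        (-1 : RatFunc ℚ) ^ r * q ^ (((r : ℤ) - 1) * ((r : ℤ) - 2) / 2) * qPoch (-q) (n + 1 - r) *
          qbinom (2 * ((n + 1 : ℕ) : ℤ) - r + 1) r *
          ((1 - q ^ (2 * (n + 1) + 1)) / (1 - q ^ (2 * ((n + 1 : ℕ) : ℤ) - r + 1))) =
      q * oddSum 0 (n + 1) - oddSum 0 n := by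
  rw [oddSum, oddSum, sum_range_succ', sum_range_succ' _ (n + 1), mul_add q, mul_sum,
    add_sub_right_comm, ← sum_sub_distrib]
  congr 1
  · refine sum_congr rfl fun s hs => ?_
    obtain ⟨j, rfl⟩ := Nat.exists_eq_add_of_le (mem_range_succ_iff.mp hs)
    have h := gaussBinom_mul_div (s + 2 * j + 1) s
    rw [show 2 * ((s + j + 1 : ℕ) : ℤ) - ((s + 1 : ℕ) : ℤ) + 1 = ((s + 2 * j + 1 + 1 : ℕ) : ℤ) by
        push_cast; ring,
      show (((s + 1 : ℕ) : ℤ) - 1) * (((s + 1 : ℕ) : ℤ) - 2) / 2 = (s.choose 2 : ℕ) by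
        rw [← choose_two_ediv]; push_cast; ring_nf,
      zpow_natCast, zpow_natCast, ← gaussBinom, mul_assoc,
      show 2 * (s + j + 1) + 1 = s + 2 * j + 1 + s + 2 by ring, h,
      show s + 2 * j + 1 + s + 2 - (s + 1) = s + 2 * j + 1 + 1 by omega,
      show 2 * (s + j) + 1 - s = s + 2 * j + 1 by omega, choose_succ_two,
      Nat.add_sub_add_right]
    ring
  · have h₁ := one_sub_q_pow_ne_zero (2 * (n + 1))
    rw [show 2 * ((n + 1 : ℕ) : ℤ) - ((0 : ℕ) : ℤ) + 1 = ((2 * (n + 1) + 1 : ℕ) : ℤ) by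
        push_cast; ring,
      zpow_natCast, ← gaussBinom, div_self h₁]
    simp [gaussBinom_zero_right]

/-- Theorem 2.3: for `n ≥ 1`,
`∑_{r=0}^n (-1)^r q^((r-1)(r-2)/2) (-q;q)_(n-r) [2n-r+1, r]_q (1-q^(2n+1))/(1-q^(2n-r+1))`
equals `(-1)^m q^((m-1)(3m-2))` if `n = 2m-1` and `(-1)^m q^(m(3m+1)+1)` if `n = 2m`. -/
theorem truncated_gauss_U_identity_shifted (n : ℕ) (hn : 1 ≤ n) (m : ℕ) :
    ((n : ℤ) = 2 * m - 1 →
      ∑ r ∈ Finset.range (n + 1),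
        (-1 : RatFunc ℚ) ^ r * q ^ (((r : ℤ) - 1) * ((r : ℤ) - 2) / 2) * qPoch (-q) (n - r) *
          qbinom (2 * (n : ℤ) - r + 1) r *
          ((1 - q ^ (2 * n + 1)) / (1 - q ^ (2 * (n : ℤ) - r + 1))) =
        (-1) ^ m * q ^ (((m : ℤ) - 1) * (3 * m - 2))) ∧
    ((n : ℤ) = 2 * m →
      ∑ r ∈ Finset.range (n + 1),
        (-1 : RatFunc ℚ) ^ r * q ^ (((r : ℤ) - 1) * ((r : ℤ) - 2) / 2) * qPoch (-q) (n - r) *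
          qbinom (2 * (n : ℤ) - r + 1) r *
          ((1 - q ^ (2 * n + 1)) / (1 - q ^ (2 * (n : ℤ) - r + 1))) =
        (-1) ^ m * q ^ ((m : ℤ) * (3 * m + 1) + 1)) := by
  obtain ⟨n, rfl⟩ := Nat.exists_eq_add_of_le' hn
  rw [sum_eq_q_mul_oddSum_sub_oddSum]
  constructor
  · intro h
    obtain ⟨k, rfl⟩ : ∃ k, m = k + 1 := Nat.exists_eq_add_of_le' (by omega)
    obtain rfl : n = 2 * k := by omega
    obtain ⟨h₁, h₂, -⟩ := oddSum_evenSum_closed_form k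
    rw [h₁, h₂, show (((k + 1 : ℕ) : ℤ) - 1) * (3 * ((k + 1 : ℕ) : ℤ) - 2) =
      ((3 * k ^ 2 + k : ℕ) : ℤ) by push_cast; ring, zpow_natCast]
    ring
  · intro h
    obtain ⟨k, rfl⟩ : ∃ k, m = k + 1 := Nat.exists_eq_add_of_le' (by omega)
    obtain rfl : n = 2 * k + 1 := by omega
    have h₁ := (oddSum_evenSum_closed_form (k + 1)).1
    have h₂ := (oddSum_evenSum_closed_form k).2.1
    rw [h₂, show 2 * k + 1 + 1 = 2 * (k + 1) by ring, h₁,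
      show ((k + 1 : ℕ) : ℤ) * (3 * ((k + 1 : ℕ) : ℤ) + 1) + 1 =
        ((3 * (k + 1) ^ 2 + (k + 1) + 1 : ℕ) : ℤ) by push_cast; ring, zpow_natCast]
    ring
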